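/- For every nonempty I ⊆ [n]: if v(I) = 1 (i.e. I is nested) then y_I = (−1)^{|I ∖ R_{δ_1}|} · ( z_{R_{δ_1}} − z_{R_{δ_2}} − z_{R_{δ_3}} + z_{R_{δ_4}} ), using the extended values of R and z for non-proper and degenerate diagonals; and if v(I) ≥ 2 then y_I = 0. -/

import Mathlib

open Finset

attribute [local instance] Classical.propDecidable

namespace AssocPaper

/-- `x` and `y` are consecutive elements of the finite set `S`. -/
def ConsecIn (S : Finset ℕ) (x y : ℕ) : Prop :=
  x ∈ S ∧ y ∈ S ∧ x < y ∧ ∀ z ∈ S, ¬ (x < z ∧ z < y)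

/-- `D̄ = D ∪ {0, n+1}`. -/
def Dbar (n : ℕ) (D : Finset ℕ) : Finset ℕ := insert 0 (insert (n + 1) D)

/-- The boundary edges of the `c`-labeled `(n+2)`-gon, given by endpoints `x < y`:
pairs of consecutive elements of `D̄`; if `U ≠ ∅` also `{0, min U}`, `{max U, n+1}` and
pairs of consecutive elements of `U`; if `U = ∅` also `{0, n+1}`. -/
def IsBoundary (n : ℕ) (D U : Finset ℕ) (x y : ℕ) : Prop :=
  ConsecIn (Dbar n D) x y
    ∨ (U.Nonempty ∧
        ((x = 0 ∧ y ∈ U ∧ ∀ u ∈ U, y ≤ u)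
          ∨ (y = n + 1 ∧ x ∈ U ∧ ∀ u ∈ U, u ≤ x)
          ∨ ConsecIn U x y))
    ∨ (U = ∅ ∧ x = 0 ∧ y = n + 1)

/-- `{x, y}` (with `x < y ≤ n+1`) is a proper diagonal: a diagonal of the
`(n+2)`-gon which is not a boundary edge. -/
def IsProper (n : ℕ) (D U : Finset ℕ) (x y : ℕ) : Prop :=
  x < y ∧ y ≤ n + 1 ∧ ¬ IsBoundary n D U x y

/-- The set `R_δ` for a proper diagonal `δ = {x,y}` with `x < y`. -/
noncomputable def Rdiag (n : ℕ) (D U : Finset ℕ) (x y : ℕ) : Finset ℕ :=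
  if x ∈ U then
    (if y ∈ U then (D ∪ U.filter fun u => u ≤ x) ∪ U.filter fun u => y ≤ u
     else D.filter (fun d => d < y) ∪ U.filter fun u => u ≤ x)
  else
    (if y ∈ U then D.filter (fun d => x < d) ∪ U.filter fun u => y ≤ u
     else D.filter fun d => x < d ∧ d < y)

/-- The extension of `R` to non-proper and degenerate diagonals `δ = {x,y}`, `x ≤ y`:
`R_δ = [n]` if `U = ∅` and `δ = {0,n+1}`; for other non-proper or degenerate `δ`,
`R_δ = ∅` if `x,y ∈ D̄` and `R_δ = [n]` otherwise. -/
noncomputable def Rext (n : ℕ) (D U : Finset ℕ) (x y : ℕ) : Finset ℕ :=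
  if IsProper n D U x y then Rdiag n D U x y
  else if U = ∅ ∧ x = 0 ∧ y = n + 1 then Finset.Icc 1 n
  else if x ∈ U ∨ y ∈ U then Finset.Icc 1 n
  else ∅

/-- The extension of the right-hand sides `z_{R_δ}` to non-proper and degenerate
diagonals, given the values `w` on proper diagonals and the value `zn = z_{[n]}`. -/
noncomputable def zext (n : ℕ) (D U : Finset ℕ) (w : ℕ × ℕ → ℝ) (zn : ℝ) (x y : ℕ) : ℝ :=
  if IsProper n D U x y then w (x, y)
  else if U = ∅ ∧ x = 0 ∧ y = n + 1 then zn
  else if x ∈ U ∨ y ∈ U then zn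
  else 0

/-- `a(I)`: the largest element of `D ∪ {0}` smaller than `min I`. -/
noncomputable def aI (D I : Finset ℕ) : ℕ :=
  ((insert 0 D).filter fun e => ∀ i ∈ I, e < i).sup id

/-- `b(I)`: the smallest element of `D ∪ {n+1}` larger than `max I`. -/
noncomputable def bI (n : ℕ) (D I : Finset ℕ) : ℕ :=
  sInf {e : ℕ | e ∈ insert (n + 1) D ∧ ∀ i ∈ I, i < e}

/-- The minimum element `γ` of `I` (junk value for `I = ∅`). -/
noncomputable def minEl (I : Finset ℕ) : ℕ := sInf {i : ℕ | i ∈ I}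

/-- The maximum element `Γ` of `I` (junk value `0` for `I = ∅`). -/
noncomputable def maxEl (I : Finset ℕ) : ℕ := I.sup id

/-- A nonempty `I ⊆ [n]` is nested if every `d ∈ D` with `a(I) < d < b(I)` lies in `I`. -/
def IsNested (n : ℕ) (D I : Finset ℕ) : Prop :=
  I.Nonempty ∧ I ⊆ Finset.Icc 1 n ∧
    ∀ d ∈ D, aI D I < d → d < bI n D I → d ∈ I

/-- The nested components of `I`: the inclusion-maximal nested subsets of `I`. -/
noncomputable def nestedComponents (n : ℕ) (D I : Finset ℕ) : Finset (Finset ℕ) :=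
  I.powerset.filter fun J =>
    IsNested n D J ∧ ∀ K ∈ I.powerset, IsNested n D K → J ⊆ K → J = K

/-- `v(I)`: the number of nested components of `I`. -/
noncomputable def vI (n : ℕ) (D I : Finset ℕ) : ℕ := (nestedComponents n D I).card

/-- `x` is the last element of one of the up intervals of `J`
(an element of `J ∩ U` whose successor in `U`, if any, is not in `J`). -/
def IsRunEnd (U J : Finset ℕ) (x : ℕ) : Prop :=
  x ∈ J ∧ x ∈ U ∧ ∀ y, ConsecIn U x y → y ∉ J

/-- `y` is the first element of one of the up intervals of `J`
(an element of `J ∩ U` whose predecessor in `U`, if any, is not in `J`). -/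
def IsRunStart (U J : Finset ℕ) (y : ℕ) : Prop :=
  y ∈ J ∧ y ∈ U ∧ ∀ x, ConsecIn U x y → x ∉ J

/-- `{x,y}` is one of the diagonals `δ_1(J), …, δ_{w+1}(J)` associated to a nested
set `J` with `a = a(J)`, `b = b(J)` and up intervals `[α_1,β_1]_U, …, [α_w,β_w]_U`,
namely `{a,α_1}, {β_1,α_2}, …, {β_w,b}` (and `{a,b}` when `w = 0`). -/
def AssocDiag (n : ℕ) (D U J : Finset ℕ) (x y : ℕ) : Prop :=
  x < y ∧ (x = aI D J ∨ IsRunEnd U J x) ∧ (y = bI n D J ∨ IsRunStart U J y) ∧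
    ∀ u ∈ J ∩ U, ¬ (x < u ∧ u < y)

/-- `W(J)`: the proper diagonals among the diagonals associated to the nested set `J`. -/
noncomputable def WJ (n : ℕ) (D U J : Finset ℕ) : Finset (ℕ × ℕ) :=
  (Finset.range (n + 2) ×ˢ Finset.range (n + 2)).filter fun p =>
    AssocDiag n D U J p.1 p.2 ∧ IsProper n D U p.1 p.2

/-- The tight value `z^c_I = ∑_i ( ∑_{j ∈ W(J_i)} w_{δ_j(J_i)} − (|W(J_i)|−1)·z_{[n]} )`,
the sum running over the nested components `J_i` of `I` (so `z^c_∅ = 0`). -/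
noncomputable def zc (n : ℕ) (D U : Finset ℕ) (w : ℕ × ℕ → ℝ) (zn : ℝ) (I : Finset ℕ) : ℝ :=
  ∑ J ∈ nestedComponents n D I,
    ((∑ p ∈ WJ n D U J, w p) - (((WJ n D U J).card : ℝ) - 1) * zn)

/-- The Minkowski coefficient `y_I = ∑_{J ⊆ I} (−1)^{|I∖J|} z^c_J`. -/
noncomputable def yI (n : ℕ) (D U : Finset ℕ) (w : ℕ × ℕ → ℝ) (zn : ℝ) (I : Finset ℕ) : ℝ :=
  ∑ J ∈ I.powerset, (-1 : ℝ) ^ (I \ J).card * zc n D U w zn J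

/-- The associahedron right-hand sides `w_δ = |R_δ|·(|R_δ|+1)/2`. -/
noncomputable def wAs (n : ℕ) (D U : Finset ℕ) (p : ℕ × ℕ) : ℝ :=
  (((Rdiag n D U p.1 p.2).card : ℝ) * (((Rdiag n D U p.1 p.2).card : ℝ) + 1)) / 2

/-- The associahedron value `z_{[n]} = n(n+1)/2`. -/
noncomputable def znAs (n : ℕ) : ℝ := ((n : ℝ) * ((n : ℝ) + 1)) / 2


/-! ### Basic facts on `a(I)`, `b(I)` and nestedness -/

lemma aI_mem (D I : Finset ℕ) : aI D I = 0 ∨ aI D I ∈ D := by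
  unfold aI
  by_cases h : ((insert 0 D).filter fun e => ∀ i ∈ I, e < i).Nonempty
  · obtain ⟨x, hx, hx2⟩ := Finset.exists_mem_eq_sup _ h id
    rw [hx2]
    simp only [Finset.mem_filter, Finset.mem_insert] at hx
    exact hx.1
  · rw [Finset.not_nonempty_iff_eq_empty] at h
    rw [h]; left; rfl

lemma le_aI {D I : Finset ℕ} {d : ℕ} (hd : d ∈ D) (h : ∀ i ∈ I, d < i) : d ≤ aI D I := by
  unfold aI
  exact Finset.le_sup (f := id) (by simp only [Finset.mem_filter, Finset.mem_insert]; exact ⟨Or.inr hd, h⟩)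

lemma aI_lt {n : ℕ} {D I : Finset ℕ} (hI : I ⊆ Finset.Icc 1 n) {i : ℕ} (hi : i ∈ I) : aI D I < i := by
  have h1 := hI hi
  rw [Finset.mem_Icc] at h1
  unfold aI
  rw [Finset.sup_lt_iff (by simp only [Nat.bot_eq_zero]; omega)]
  intro e he
  simp only [Finset.mem_filter] at he
  exact he.2 i hi

lemma bI_spec {n : ℕ} {D I : Finset ℕ} (hI : I ⊆ Finset.Icc 1 n) :
    (bI n D I = n + 1 ∨ bI n D I ∈ D) ∧ ∀ i ∈ I, i < bI n D I := by
  have : bI n D I ∈ {e : ℕ | e ∈ insert (n + 1) D ∧ ∀ i ∈ I, i < e} := by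
    apply Nat.sInf_mem
    refine ⟨n + 1, by simp, fun i hi => ?_⟩
    have := hI hi
    rw [Finset.mem_Icc] at this
    omega
  simpa using this

lemma bI_le {n : ℕ} {D I : Finset ℕ} {d : ℕ} (hd : d ∈ D ∨ d = n + 1) (h : ∀ i ∈ I, i < d) :
    bI n D I ≤ d := by
  apply Nat.sInf_le
  refine ⟨?_, h⟩
  simp only [Finset.mem_insert]
  tauto

lemma isNested_iff {n : ℕ} {D I : Finset ℕ} (hne : I.Nonempty) (hI : I ⊆ Finset.Icc 1 n) :
    IsNested n D I ↔ ∀ d ∈ D, ∀ i ∈ I, ∀ j ∈ I, i ≤ d → d ≤ j → d ∈ I := by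
  constructor
  · rintro ⟨_, _, h⟩ d hd i hi j hj hid hdj
    exact h d hd (lt_of_lt_of_le (aI_lt hI hi) hid) (lt_of_le_of_lt hdj ((bI_spec hI).2 j hj))
  · intro h
    refine ⟨hne, hI, fun d hd h1 h2 => ?_⟩
    have e1 : ∃ i ∈ I, i ≤ d := by
      by_contra hc
      push Not at hc
      exact absurd (le_aI hd hc) (by omega)
    have e2 : ∃ i ∈ I, d ≤ i := by
      by_contra hc
      push Not at hc
      exact absurd (bI_le (n := n) (Or.inl hd) hc) (by omega)
    obtain ⟨i, hi, hi'⟩ := e1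
    obtain ⟨j, hj, hj'⟩ := e2
    exact h d hd i hi j hj hi' hj'

/-- Overlapping nested sets have a nested union. -/
lemma nested_union {n : ℕ} {D K L : Finset ℕ} (hK : IsNested n D K) (hL : IsNested n D L)
    (h1 : aI D K < bI n D L) (h2 : aI D L < bI n D K) : IsNested n D (K ∪ L) := by
  have hsub : K ∪ L ⊆ Finset.Icc 1 n := Finset.union_subset hK.2.1 hL.2.1
  rw [isNested_iff (hK.1.mono Finset.subset_union_left) hsub]
  intro d hd i hi j hj hid hdj
  have k1 := hK.2.2 d hd
  have l1 := hL.2.2 d hd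
  have ka : ∀ x ∈ K, aI D K < x := fun x hx => aI_lt hK.2.1 hx
  have la : ∀ x ∈ L, aI D L < x := fun x hx => aI_lt hL.2.1 hx
  have kb := (bI_spec (D := D) hK.2.1).2
  have lb := (bI_spec (D := D) hL.2.1).2
  rw [Finset.mem_union] at hi hj ⊢
  by_contra hc
  push Not at hc
  have k2 : aI D K < d → bI n D K ≤ d := fun h => by
    by_contra h'; exact hc.1 (k1 h (by omega))
  have l2 : aI D L < d → bI n D L ≤ d := fun h => by
    by_contra h'; exact hc.2 (l1 h (by omega))
  rcases hi with hi | hi <;> rcases hj with hj | hj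
  · have := ka i hi; have := kb j hj; omega
  · have := ka i hi; have := lb j hj; omega
  · have := la i hi; have := kb j hj; omega
  · have := la i hi; have := lb j hj; omega

lemma nested_singleton {n : ℕ} (D : Finset ℕ) {i : ℕ} (hi : i ∈ Finset.Icc 1 n) : IsNested n D {i} := by
  rw [isNested_iff (Finset.singleton_nonempty i) (by simpa using hi)]
  intro d _ x hx y hy h1 h2
  simp only [Finset.mem_singleton] at *
  omega

/-! ### Nested components -/

lemma mem_comp {n : ℕ} {D J K : Finset ℕ} : K ∈ nestedComponents n D J ↔
    K ⊆ J ∧ IsNested n D K ∧ ∀ L ⊆ J, IsNested n D L → K ⊆ L → K = L := by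
  simp [nestedComponents]

lemma exists_comp {n : ℕ} {D J L : Finset ℕ} (hL : IsNested n D L) (hLJ : L ⊆ J) :
    ∃ K ∈ nestedComponents n D J, L ⊆ K := by
  let F := J.powerset.filter fun K => IsNested n D K ∧ L ⊆ K
  have hF : F.Nonempty := ⟨L, by simp [F, hL, hLJ]⟩
  obtain ⟨K, hK, hmax⟩ := Finset.exists_max_image F Finset.card hF
  simp only [F, Finset.mem_filter, Finset.mem_powerset] at hK hmax
  refine ⟨K, mem_comp.2 ⟨hK.1, hK.2.1, fun M hM hMn hKM => ?_⟩, hK.2.2⟩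
  exact Finset.eq_of_subset_of_card_le hKM (hmax M ⟨hM, hMn, hK.2.2.trans hKM⟩)

lemma comp_absorb {n : ℕ} {D J K L : Finset ℕ} (hK : K ∈ nestedComponents n D J)
    (hL : IsNested n D L) (hLJ : L ⊆ J)
    (h1 : aI D K < bI n D L) (h2 : aI D L < bI n D K) : L ⊆ K := by
  rw [mem_comp] at hK
  have := hK.2.2 (K ∪ L) (Finset.union_subset hK.1 hLJ) (nested_union hK.2.1 hL h1 h2)
    Finset.subset_union_left
  rw [this]; exact Finset.subset_union_right

lemma comp_eq {n : ℕ} {D J K L : Finset ℕ} (hK : K ∈ nestedComponents n D J)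
    (hL : L ∈ nestedComponents n D J)
    (h1 : aI D K < bI n D L) (h2 : aI D L < bI n D K) : K = L := by
  have hK' := mem_comp.1 hK
  have hL' := mem_comp.1 hL
  exact Finset.Subset.antisymm (comp_absorb hL hK'.2.1 hK'.1 h2 h1)
    (comp_absorb hK hL'.2.1 hL'.1 h1 h2)

lemma comp_mem_of_between {n : ℕ} {D J K : Finset ℕ} (hJ : J ⊆ Finset.Icc 1 n)
    (hK : K ∈ nestedComponents n D J) {r : ℕ} (hr : r ∈ J)
    (h1 : aI D K ≤ r) (h2 : r ≤ bI n D K) : r ∈ K := by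
  have hs : ({r} : Finset ℕ) ⊆ Finset.Icc 1 n := by simpa using hJ hr
  have a1 := aI_lt (D := D) hs (Finset.mem_singleton_self r)
  have a2 := (bI_spec (D := D) hs).2 r (Finset.mem_singleton_self r)
  have := comp_absorb hK (nested_singleton D (hJ hr)) (by simpa using hr) (by omega) (by omega)
  simpa using this

lemma nested_iff_vI {n : ℕ} {D I : Finset ℕ} (hne : I.Nonempty) (hsub : I ⊆ Finset.Icc 1 n) :
    (vI n D I = 1 ↔ IsNested n D I) := by
  unfold vI
  constructor
  · intro h
    obtain ⟨K, hK⟩ := Finset.card_eq_one.1 h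
    have hKm : K ∈ nestedComponents n D I := by rw [hK]; simp
    have : K = I := by
      apply Finset.Subset.antisymm (mem_comp.1 hKm).1
      intro i hi
      obtain ⟨L, hL, hiL⟩ := exists_comp (J := I) (nested_singleton D (hsub hi)) (by simpa using hi)
      rw [hK, Finset.mem_singleton] at hL
      rw [← hL]; simpa using hiL
    rw [← this]; exact (mem_comp.1 hKm).2.1
  · intro h
    rw [Finset.card_eq_one]
    refine ⟨I, ?_⟩
    ext K
    rw [mem_comp, Finset.mem_singleton]
    constructor
    · rintro ⟨h1, _, h3⟩
      exact h3 I (Finset.Subset.refl I) h h1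
    · rintro rfl
      exact ⟨Finset.Subset.refl _, h, fun L hL _ hL2 => Finset.Subset.antisymm hL2 hL⟩

/-! ### Consecutive pairs -/

/-- All consecutive pairs of `S` inside `{0,…,n+1}`. -/
noncomputable def cpairs (n : ℕ) (S : Finset ℕ) : Finset (ℕ × ℕ) :=
  (Finset.range (n + 2) ×ˢ Finset.range (n + 2)).filter fun p => ConsecIn S p.1 p.2

lemma mem_cpairs {n : ℕ} {S : Finset ℕ} (hS : S ⊆ Finset.range (n + 2)) {p : ℕ × ℕ} :
    p ∈ cpairs n S ↔ ConsecIn S p.1 p.2 := by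
  unfold cpairs
  rw [Finset.mem_filter, Finset.mem_product]
  constructor
  · exact fun h => h.2
  · exact fun h => ⟨⟨hS h.1, hS h.2.1⟩, h⟩

lemma card_cpairs {n : ℕ} {S : Finset ℕ} (hS : S ⊆ Finset.range (n + 2)) {m : ℕ} (hm : m ∈ S)
    (hmin : ∀ x ∈ S, m ≤ x) : (cpairs n S).card + 1 = S.card := by
  rw [← Finset.card_erase_add_one hm]
  congr 1
  apply Finset.card_bij (fun p _ => p.2)
  · intro p hp
    rw [mem_cpairs hS] at hp
    obtain ⟨h1, h2, h3, h4⟩ := hp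
    rw [Finset.mem_erase]
    have := hmin _ h1
    exact ⟨by omega, h2⟩
  · rintro ⟨x, y⟩ hp ⟨x', y'⟩ hq h
    rw [mem_cpairs hS] at hp hq
    obtain ⟨h1, h2, h3, h4⟩ := hp
    obtain ⟨g1, g2, g3, g4⟩ := hq
    simp only at *
    subst h
    have := h4 _ g1
    have := g4 _ h1
    ext <;> simp only <;> omega
  · intro y hy
    rw [Finset.mem_erase] at hy
    have hne : (S.filter fun x => x < y).Nonempty :=
      ⟨m, by rw [Finset.mem_filter]; have := hmin y hy.2; exact ⟨hm, by omega⟩⟩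
    obtain ⟨x, hx, hmax⟩ := Finset.exists_max_image _ id hne
    rw [Finset.mem_filter] at hx
    refine ⟨(x, y), ?_, rfl⟩
    rw [mem_cpairs hS]
    refine ⟨hx.1, hy.2, hx.2, fun z hz hxz => ?_⟩
    have := hmax z (by rw [Finset.mem_filter]; exact ⟨hz, hxz.2⟩)
    simp only [id] at this
    omega

/-! ### Closed formula for the tight values -/

/-- The vertices of the upper path of a nested set. -/
noncomputable def TJ (n : ℕ) (D U K : Finset ℕ) : Finset ℕ :=
  insert (aI D K) (insert (bI n D K) (K ∩ U))

/-- The set `(D̄ \ J) ∪ (J ∩ U)`. -/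
noncomputable def SJ (n : ℕ) (D U J : Finset ℕ) : Finset ℕ :=
  (Dbar n D \ J) ∪ (J ∩ U)

lemma mem_TJ {n : ℕ} {D U K : Finset ℕ} {x : ℕ} :
    x ∈ TJ n D U K ↔ x = aI D K ∨ x = bI n D K ∨ (x ∈ K ∧ x ∈ U) := by
  simp [TJ]

lemma mem_SJ {n : ℕ} {D U J : Finset ℕ} {x : ℕ} :
    x ∈ SJ n D U J ↔ ((x = 0 ∨ x = n + 1 ∨ x ∈ D) ∧ x ∉ J) ∨ (x ∈ J ∧ x ∈ U) := by
  simp [SJ, Dbar]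

lemma SJ_subset {n : ℕ} {D U J : Finset ℕ} (hD : D ⊆ Finset.Icc 1 n)
    (hJ : J ⊆ Finset.Icc 1 n) : SJ n D U J ⊆ Finset.range (n + 2) := by
  intro x hx
  rw [mem_SJ] at hx
  rw [Finset.mem_range]
  rcases hx with ⟨h | h | h, _⟩ | ⟨h, _⟩
  · omega
  · omega
  · have := hD h; rw [Finset.mem_Icc] at this; omega
  · have := hJ h; rw [Finset.mem_Icc] at this; omega

lemma bI_le_n {n : ℕ} {D K : Finset ℕ} (hK : K ⊆ Finset.Icc 1 n) : bI n D K ≤ n + 1 := by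
  apply bI_le (Or.inr rfl)
  intro i hi
  have := hK hi; rw [Finset.mem_Icc] at this; omega

lemma TJ_subset {n : ℕ} {D U K : Finset ℕ} (hne : K.Nonempty)
    (hK : K ⊆ Finset.Icc 1 n) : TJ n D U K ⊆ Finset.range (n + 2) := by
  intro x hx
  rw [mem_TJ] at hx
  rw [Finset.mem_range]
  obtain ⟨i, hi⟩ := hne
  have h1 := aI_lt (D := D) hK hi
  have h2 := hK hi
  have h3 := bI_le_n (D := D) hK
  rw [Finset.mem_Icc] at h2
  rcases hx with h | h | ⟨h, _⟩
  · omega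
  · omega
  · have := hK h; rw [Finset.mem_Icc] at this; omega

lemma WJ_eq {n : ℕ} {D U K : Finset ℕ} (hK : IsNested n D K) :
    WJ n D U K = (cpairs n (TJ n D U K)).filter fun p => IsProper n D U p.1 p.2 := by
  ext ⟨x, y⟩
  simp only [WJ, Finset.mem_filter]
  rw [mem_cpairs (TJ_subset hK.1 hK.2.1)]
  have ha : ∀ i ∈ K, aI D K < i := fun i hi => aI_lt hK.2.1 hi
  have hb := (bI_spec (D := D) hK.2.1).2
  have hab : aI D K < bI n D K := by
    obtain ⟨i, hi⟩ := hK.1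
    exact (ha i hi).trans (hb i hi)
  constructor
  · rintro ⟨_, ⟨hxy, hx, hy, hu⟩, hp⟩
    have hx' : x ∈ TJ n D U K := by
      rw [mem_TJ]; rcases hx with h | h
      · exact Or.inl h
      · exact Or.inr (Or.inr ⟨h.1, h.2.1⟩)
    have hy' : y ∈ TJ n D U K := by
      rw [mem_TJ]; rcases hy with h | h
      · exact Or.inr (Or.inl h)
      · exact Or.inr (Or.inr ⟨h.1, h.2.1⟩)
    refine ⟨⟨hx', hy', hxy, ?_⟩, hp⟩
    intro z hz hxz
    rw [mem_TJ] at hz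
    rcases hz with h | h | h
    · have : aI D K ≤ x := by
        rcases hx with h | h
        · omega
        · exact (ha x h.1).le
      omega
    · have : y ≤ bI n D K := by
        rcases hy with h | h
        · omega
        · exact (hb y h.1).le
      omega
    · exact hu z (Finset.mem_inter.2 h) hxz
  · rintro ⟨⟨hx, hy, hxy, hc⟩, hp⟩
    have hr := TJ_subset (D := D) (U := U) hK.1 hK.2.1
    refine ⟨Finset.mem_product.2 ⟨hr hx, hr hy⟩, ⟨hxy, ?_, ?_, ?_⟩, hp⟩
    · rw [mem_TJ] at hx hy
      rcases hx with h | h | h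
      · exact Or.inl h
      · rcases hy with g | g | g
        · simp only at *; omega
        · simp only at *; omega
        · have := hb y g.1; simp only at *; omega
      · refine Or.inr ⟨h.1, h.2, fun z hz hzK => ?_⟩
        have hzT : z ∈ TJ n D U K := mem_TJ.2 (Or.inr (Or.inr ⟨hzK, hz.2.1⟩))
        have h1 := hc z hzT
        have h2 := hz.2.2.1
        simp only at *
        rcases hy with g | g | g
        · have := ha x h.1; omega
        · have := hb z hzK; omega
        · have h3 := hz.2.2.2 y g.2
          have : z = y := by omega
          subst this
          exact hp.2.2 (Or.inr (Or.inl ⟨⟨z, g.2⟩, Or.inr (Or.inr hz)⟩))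
    · rw [mem_TJ] at hx hy
      rcases hy with h | h | h
      · rcases hx with g | g | g
        · simp only at *; omega
        · simp only at *; omega
        · have := ha x g.1; simp only at *; omega
      · exact Or.inl h
      · refine Or.inr ⟨h.1, h.2, fun z hz hzK => ?_⟩
        have hzT : z ∈ TJ n D U K := mem_TJ.2 (Or.inr (Or.inr ⟨hzK, hz.1⟩))
        have h1 := hc z hzT
        have h2 := hz.2.2.1
        simp only at *
        rcases hx with g | g | g
        · have := ha z hzK; omega
        · have := hb y h.1; omega
        · have h3 := hz.2.2.2 x g.2
          have : z = x := by omega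
          subst this
          exact hp.2.2 (Or.inr (Or.inl ⟨⟨z, g.2⟩, Or.inr (Or.inr hz)⟩))
    · intro u hu
      exact hc u (mem_TJ.2 (Or.inr (Or.inr (Finset.mem_inter.1 hu))))

lemma term_eq {n : ℕ} {D U K : Finset ℕ} (hDU : D ∪ U = Finset.Icc 1 n) (hdisj : Disjoint D U)
    (w : ℕ × ℕ → ℝ) (zn : ℝ) (hK : IsNested n D K) :
    (∑ p ∈ WJ n D U K, w p) - (((WJ n D U K).card : ℝ) - 1) * zn
      = (∑ p ∈ cpairs n (TJ n D U K), zext n D U w zn p.1 p.2) - ((K ∩ U).card : ℝ) * zn := by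
  have hU : U ⊆ Finset.Icc 1 n := hDU ▸ Finset.subset_union_right
  have ha : ∀ i ∈ K, aI D K < i := fun i hi => aI_lt hK.2.1 hi
  have hb := (bI_spec (D := D) hK.2.1).2
  have hab : aI D K < bI n D K := by
    obtain ⟨i, hi⟩ := hK.1
    exact (ha i hi).trans (hb i hi)
  have hT := TJ_subset (D := D) (U := U) hK.1 hK.2.1
  have hcard : ((cpairs n (TJ n D U K)).card : ℝ) = (K ∩ U).card + 1 := by
    have h1 := card_cpairs (m := aI D K) hT (mem_TJ.2 (Or.inl rfl)) (by
      intro x hx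
      rcases mem_TJ.1 hx with h | h | h
      · omega
      · omega
      · exact (ha x h.1).le)
    have h2 : (TJ n D U K).card = (K ∩ U).card + 2 := by
      unfold TJ
      rw [Finset.card_insert_of_notMem, Finset.card_insert_of_notMem]
      · intro h
        exact absurd (hb _ (Finset.mem_inter.1 h).1) (lt_irrefl _)
      · rw [Finset.mem_insert]
        rintro (h | h)
        · omega
        · exact absurd (ha _ (Finset.mem_inter.1 h).1) (lt_irrefl _)
    have : (cpairs n (TJ n D U K)).card = (K ∩ U).card + 1 := by omega
    rw [this]; push_cast; ring
  have key : ∀ p ∈ cpairs n (TJ n D U K), ¬ IsProper n D U p.1 p.2 →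
      zext n D U w zn p.1 p.2 = zn := by
    rintro ⟨x, y⟩ hp hnp
    rw [mem_cpairs hT] at hp
    obtain ⟨hx, hy, hxy, hc⟩ := hp
    have hxr := Finset.mem_range.1 (hT hy)
    simp only at *
    unfold zext
    rw [if_neg hnp]
    by_cases h2 : U = ∅ ∧ x = 0 ∧ y = n + 1
    · rw [if_pos h2]
    rw [if_neg h2]
    by_cases h3 : x ∈ U ∨ y ∈ U
    · rw [if_pos h3]
    exfalso
    push Not at h3
    have hbd : IsBoundary n D U x y := by
      by_contra h
      exact hnp ⟨hxy, by omega, h⟩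
    have hx' : x = aI D K := by
      rcases mem_TJ.1 hx with h | h | h
      · exact h
      · rcases mem_TJ.1 hy with g | g | g
        · omega
        · omega
        · exact absurd g.2 h3.2
      · exact absurd h.2 h3.1
    have hy' : y = bI n D K := by
      rcases mem_TJ.1 hy with h | h | h
      · omega
      · exact h
      · exact absurd h.2 h3.2
    rcases hbd with h | ⟨_, h | h | h⟩ | h
    · obtain ⟨i, hi⟩ := hK.1
      have i1 := ha i hi
      have i2 := hb i hi
      have : i ∈ D ∪ U := hDU ▸ hK.2.1 hi
      rcases Finset.mem_union.1 this with g | g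
      · exact h.2.2.2 i (by simp [Dbar, g]) ⟨by omega, by omega⟩
      · exact hc i (mem_TJ.2 (Or.inr (Or.inr ⟨hi, g⟩))) ⟨by omega, by omega⟩
    · exact h3.2 h.2.1
    · exact h3.1 h.2.1
    · exact h3.1 h.1
    · exact h2 h
  rw [WJ_eq hK]
  rw [← Finset.sum_filter_add_sum_filter_not (cpairs n (TJ n D U K))
    (fun p => IsProper n D U p.1 p.2) (fun p => zext n D U w zn p.1 p.2)]
  have e1 : ∑ p ∈ (cpairs n (TJ n D U K)).filter (fun p => IsProper n D U p.1 p.2),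
      zext n D U w zn p.1 p.2
      = ∑ p ∈ (cpairs n (TJ n D U K)).filter (fun p => IsProper n D U p.1 p.2), w p := by
    apply Finset.sum_congr rfl
    intro p hp
    rw [Finset.mem_filter] at hp
    unfold zext
    rw [if_pos hp.2]
  have e2 : ∑ p ∈ (cpairs n (TJ n D U K)).filter (fun p => ¬ IsProper n D U p.1 p.2),
      zext n D U w zn p.1 p.2
      = (((cpairs n (TJ n D U K)).filter (fun p => ¬ IsProper n D U p.1 p.2)).card : ℝ) * zn := by
    rw [← nsmul_eq_mul]
    apply Finset.sum_eq_card_nsmul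
    intro p hp
    rw [Finset.mem_filter] at hp
    exact key p hp.1 hp.2
  rw [e1, e2]
  have e3 := Finset.card_filter_add_card_filter_not (s := cpairs n (TJ n D U K))
    (fun p => IsProper n D U p.1 p.2)
  have e4 : (((cpairs n (TJ n D U K)).filter (fun p => IsProper n D U p.1 p.2)).card : ℝ)
      + (((cpairs n (TJ n D U K)).filter (fun p => ¬ IsProper n D U p.1 p.2)).card : ℝ)
      = (K ∩ U).card + 1 := by
    rw [← hcard, ← e3]; push_cast; ring
  linear_combination (-zn) * e4

lemma aI_not_mem {n : ℕ} {D J K : Finset ℕ} (hJ : J ⊆ Finset.Icc 1 n)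
    (hK : K ∈ nestedComponents n D J) : aI D K ∉ J := by
  intro h
  have hK' := mem_comp.1 hK
  obtain ⟨i, hi⟩ := hK'.2.1.1
  have h1 := aI_lt (D := D) hK'.2.1.2.1 hi
  have h2 := (bI_spec (D := D) hK'.2.1.2.1).2 i hi
  have := comp_mem_of_between hJ hK h le_rfl (by omega)
  exact absurd (aI_lt (D := D) hK'.2.1.2.1 this) (lt_irrefl _)

lemma bI_not_mem {n : ℕ} {D J K : Finset ℕ} (hJ : J ⊆ Finset.Icc 1 n)
    (hK : K ∈ nestedComponents n D J) : bI n D K ∉ J := by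
  intro h
  have hK' := mem_comp.1 hK
  obtain ⟨i, hi⟩ := hK'.2.1.1
  have h1 := aI_lt (D := D) hK'.2.1.2.1 hi
  have h2 := (bI_spec (D := D) hK'.2.1.2.1).2 i hi
  have := comp_mem_of_between hJ hK h (by omega) le_rfl
  exact absurd ((bI_spec (D := D) hK'.2.1.2.1).2 _ this) (lt_irrefl _)

lemma TJ_bounds {n : ℕ} {D U K : Finset ℕ} (hK : IsNested n D K) {x : ℕ}
    (hx : x ∈ TJ n D U K) : aI D K ≤ x ∧ x ≤ bI n D K := by
  have ha : ∀ i ∈ K, aI D K < i := fun i hi => aI_lt hK.2.1 hi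
  have hb := (bI_spec (D := D) hK.2.1).2
  have hab : aI D K < bI n D K := by
    obtain ⟨i, hi⟩ := hK.1
    exact (ha i hi).trans (hb i hi)
  rcases mem_TJ.1 hx with h | h | h
  · omega
  · omega
  · exact ⟨(ha x h.1).le, (hb x h.1).le⟩

lemma TJ_sub_SJ {n : ℕ} {D U J K : Finset ℕ} (hJ : J ⊆ Finset.Icc 1 n)
    (hK : K ∈ nestedComponents n D J) : TJ n D U K ⊆ SJ n D U J := by
  intro x hx
  have hK' := mem_comp.1 hK
  rw [mem_SJ]
  rcases mem_TJ.1 hx with h | h | h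
  · left
    subst h
    refine ⟨?_, aI_not_mem hJ hK⟩
    rcases aI_mem D K with g | g
    · exact Or.inl g
    · exact Or.inr (Or.inr g)
  · left
    subst h
    refine ⟨?_, bI_not_mem hJ hK⟩
    exact Or.inr (bI_spec (D := D) hK'.2.1.2.1).1
  · exact Or.inr ⟨hK'.1 h.1, h.2⟩

lemma SJ_between {n : ℕ} {D U J K : Finset ℕ} (hJ : J ⊆ Finset.Icc 1 n)
    (hK : K ∈ nestedComponents n D J) {r : ℕ} (hr : r ∈ SJ n D U J)
    (h1 : aI D K < r) (h2 : r < bI n D K) : r ∈ K ∧ r ∈ U := by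
  have hK' := mem_comp.1 hK
  rcases mem_SJ.1 hr with ⟨g | g | g, g'⟩ | g
  · omega
  · have := bI_le_n (D := D) hK'.2.1.2.1; omega
  · exact absurd (hK'.1 (hK'.2.1.2.2 r g h1 h2)) g'
  · exact ⟨comp_mem_of_between hJ hK g.1 h1.le h2.le, g.2⟩

/-- Consecutive pairs of `SJ` not consecutive in `D̄` come from a unique component. -/
lemma cpairs_SJ {n : ℕ} {D U J : Finset ℕ} (hDU : D ∪ U = Finset.Icc 1 n)
    (hdisj : Disjoint D U) (hJ : J ⊆ Finset.Icc 1 n) :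
    (cpairs n (SJ n D U J)).filter (fun p => ¬ ConsecIn (Dbar n D) p.1 p.2)
      = (nestedComponents n D J).biUnion fun K => cpairs n (TJ n D U K) := by
  have hD : D ⊆ Finset.Icc 1 n := hDU ▸ Finset.subset_union_left
  have hU : U ⊆ Finset.Icc 1 n := hDU ▸ Finset.subset_union_right
  ext ⟨p, q⟩
  rw [Finset.mem_filter, Finset.mem_biUnion, mem_cpairs (SJ_subset hD hJ)]
  constructor
  · rintro ⟨⟨hp, hq, hpq, hc⟩, hnd⟩
    simp only at *
    have hDJ : ∀ d ∈ D, p < d → d < q → d ∈ J := by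
      intro d hd h1 h2
      by_contra h
      exact hc d (mem_SJ.2 (Or.inl ⟨Or.inr (Or.inr hd), h⟩)) ⟨h1, h2⟩
    have hpD : p ∈ J → p ∉ D := by
      intro h1 h2
      rcases mem_SJ.1 hp with h | h
      · exact h.2 h1
      · exact Finset.disjoint_left.1 hdisj h2 h.2
    have hqD : q ∈ J → q ∉ D := by
      intro h1 h2
      rcases mem_SJ.1 hq with h | h
      · exact h.2 h1
      · exact Finset.disjoint_left.1 hdisj h2 h.2
    let L := J.filter fun x => p ≤ x ∧ x ≤ q
    have hLJ : L ⊆ J := Finset.filter_subset _ _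
    have hmL : ∀ x, x ∈ L ↔ x ∈ J ∧ p ≤ x ∧ x ≤ q := fun x => Finset.mem_filter
    have hLne : L.Nonempty := by
      rcases mem_SJ.1 hp with hp' | hp'
      · rcases mem_SJ.1 hq with hq' | hq'
        · by_contra hLe
          apply hnd
          refine ⟨by simpa [Dbar] using hp'.1, by simpa [Dbar] using hq'.1, hpq, ?_⟩
          rintro z hz ⟨h1, h2⟩
          have hq2 : q ≤ n + 1 := by
            have := Finset.mem_range.1 (SJ_subset hD hJ hq); omega
          have hzD : z ∈ D := by
            simp only [Dbar, Finset.mem_insert] at hz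
            rcases hz with h | h | h
            · omega
            · omega
            · exact h
          exact hLe ⟨z, (hmL z).2 ⟨hDJ z hzD h1 h2, h1.le, h2.le⟩⟩
        · exact ⟨q, (hmL q).2 ⟨hq'.1, hpq.le, le_rfl⟩⟩
      · exact ⟨p, (hmL p).2 ⟨hp'.1, le_rfl, hpq.le⟩⟩
    have hLn : IsNested n D L := by
      rw [isNested_iff hLne (hLJ.trans hJ)]
      intro d hd i hi j hj hid hdj
      have hi' := (hmL i).1 hi
      have hj' := (hmL j).1 hj
      rw [hmL]
      refine ⟨?_, by omega, by omega⟩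
      by_cases h1 : p = d
      · have : i = d := by omega
        exact this ▸ hi'.1
      · by_cases h2 : q = d
        · have : j = d := by omega
          exact this ▸ hj'.1
        · exact hDJ d hd (by omega) (by omega)
    obtain ⟨K, hK, hLK⟩ := exists_comp hLn hLJ
    have hK' := mem_comp.1 hK
    obtain ⟨i, hi⟩ := hLne
    have hi' := (hmL i).1 hi
    have ha : ∀ i ∈ K, aI D K < i := fun i hi => aI_lt hK'.2.1.2.1 hi
    have hb := (bI_spec (D := D) hK'.2.1.2.1).2
    have hiK := hLK hi
    have hconv := (isNested_iff hK'.2.1.1 hK'.2.1.2.1).1 hK'.2.1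
    have h0 : 0 ∉ J := fun h => by have := hJ h; rw [Finset.mem_Icc] at this; omega
    have hn1 : n + 1 ∉ J := fun h => by have := hJ h; rw [Finset.mem_Icc] at this; omega
    have hSJb := SJ_subset (U := U) hD hJ
    have hpT : p ∈ TJ n D U K := by
      rcases mem_SJ.1 hp with hp' | hp'
      · rw [mem_TJ]; left
        have hpi : p < i := by
          rcases Nat.lt_or_ge p i with h | h
          · exact h
          · have : i = p := by omega
            exact absurd (this ▸ hi'.1) hp'.2
        have hle : p ≤ aI D K := by
          rcases hp'.1 with h | h | h
          · omega
          · have := Finset.mem_range.1 (hSJb hq); omega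
          · apply le_aI h
            intro k hk
            by_contra hkp
            exact hp'.2 (hK'.1 (hconv p h k hk i hiK (by omega) hpi.le))
        by_contra hne
        have hai := ha i hiK
        rcases aI_mem D K with h | h
        · omega
        · have : aI D K ∈ J := hDJ _ h (by omega) (by omega)
          exact aI_not_mem hJ hK this
      · rw [mem_TJ]; right; right
        exact ⟨hLK ((hmL p).2 ⟨hp'.1, le_rfl, hpq.le⟩), hp'.2⟩
    have hqT : q ∈ TJ n D U K := by
      rcases mem_SJ.1 hq with hq' | hq'
      · rw [mem_TJ]; right; left
        have hqi : i < q := by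
          rcases Nat.lt_or_ge i q with h | h
          · exact h
          · have : i = q := by omega
            exact absurd (this ▸ hi'.1) hq'.2
        have hle : bI n D K ≤ q := by
          rcases hq'.1 with h | h | h
          · omega
          · rw [h]; exact bI_le_n hK'.2.1.2.1
          · apply bI_le (Or.inl h)
            intro k hk
            by_contra hkp
            exact hq'.2 (hK'.1 (hconv q h i hiK k hk hqi.le (by omega)))
        by_contra hne
        have hai := hb i hiK
        rcases (bI_spec (D := D) hK'.2.1.2.1).1 with h | h
        · have := Finset.mem_range.1 (hSJb hq); omega
        · have : bI n D K ∈ J := hDJ _ h (by omega) (by omega)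
          exact bI_not_mem hJ hK this
      · rw [mem_TJ]; right; right
        exact ⟨hLK ((hmL q).2 ⟨hq'.1, hpq.le, le_rfl⟩), hq'.2⟩
    refine ⟨K, hK, ?_⟩
    rw [mem_cpairs (TJ_subset hK'.2.1.1 hK'.2.1.2.1)]
    exact ⟨hpT, hqT, hpq, fun z hz => hc z (TJ_sub_SJ hJ hK hz)⟩
  · rintro ⟨K, hK, hpK⟩
    have hK' := mem_comp.1 hK
    rw [mem_cpairs (TJ_subset hK'.2.1.1 hK'.2.1.2.1)] at hpK
    obtain ⟨hp, hq, hpq, hc⟩ := hpK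
    simp only at *
    have bp := TJ_bounds hK'.2.1 hp
    have bq := TJ_bounds hK'.2.1 hq
    refine ⟨⟨TJ_sub_SJ hJ hK hp, TJ_sub_SJ hJ hK hq, hpq, ?_⟩, ?_⟩
    · rintro z hz ⟨h1, h2⟩
      have := SJ_between hJ hK hz (by omega) (by omega)
      exact hc z (mem_TJ.2 (Or.inr (Or.inr this))) ⟨h1, h2⟩
    · rintro ⟨h1, h2, _, h4⟩
      have hUD : ∀ x ∈ U, x ∉ Dbar n D := by
        intro x hx h
        have := hU hx
        rw [Finset.mem_Icc] at this
        simp only [Dbar, Finset.mem_insert] at h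
        rcases h with h | h | h
        · omega
        · omega
        · exact Finset.disjoint_left.1 hdisj h hx
      have hpa : p = aI D K := by
        rcases mem_TJ.1 hp with h | h | h
        · exact h
        · omega
        · exact absurd h1 (hUD p h.2)
      have hqb : q = bI n D K := by
        rcases mem_TJ.1 hq with h | h | h
        · omega
        · exact h
        · exact absurd h2 (hUD q h.2)
      obtain ⟨i, hi⟩ := hK'.2.1.1
      have i1 := aI_lt (D := D) hK'.2.1.2.1 hi
      have i2 := (bI_spec (D := D) hK'.2.1.2.1).2 i hi
      have : i ∈ D ∪ U := hDU ▸ hK'.2.1.2.1 hi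
      rcases Finset.mem_union.1 this with g | g
      · exact h4 i (by simp [Dbar, g]) ⟨by omega, by omega⟩
      · exact hc i (mem_TJ.2 (Or.inr (Or.inr ⟨hi, g⟩))) ⟨by omega, by omega⟩

lemma zext_consec {n : ℕ} {D U : Finset ℕ} (hDU : D ∪ U = Finset.Icc 1 n) (hdisj : Disjoint D U)
    (h1D : 1 ∈ D) (w : ℕ × ℕ → ℝ) (zn : ℝ) {x y : ℕ} (h : ConsecIn (Dbar n D) x y) :
    zext n D U w zn x y = 0 := by
  have hU : U ⊆ Finset.Icc 1 n := hDU ▸ Finset.subset_union_right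
  have hD : D ⊆ Finset.Icc 1 n := hDU ▸ Finset.subset_union_left
  have h1 := hD h1D
  rw [Finset.mem_Icc] at h1
  have hUD : ∀ x ∈ U, x ∉ Dbar n D := by
    intro x hx h
    have := hU hx
    rw [Finset.mem_Icc] at this
    simp only [Dbar, Finset.mem_insert] at h
    rcases h with h | h | h
    · omega
    · omega
    · exact Finset.disjoint_left.1 hdisj h hx
  unfold zext
  rw [if_neg (fun hp => hp.2.2 (Or.inl h)), if_neg, if_neg]
  · rintro (g | g)
    · exact hUD x g h.1
    · exact hUD y g h.2.1
  · rintro ⟨_, g1, g2⟩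
    exact h.2.2.2 1 (by simp [Dbar, h1D]) ⟨by omega, by omega⟩

lemma zc_eq {n : ℕ} {D U J : Finset ℕ} (hDU : D ∪ U = Finset.Icc 1 n) (hdisj : Disjoint D U)
    (h1D : 1 ∈ D) (w : ℕ × ℕ → ℝ) (zn : ℝ) (hJ : J ⊆ Finset.Icc 1 n) :
    zc n D U w zn J = (∑ p ∈ cpairs n (SJ n D U J), zext n D U w zn p.1 p.2)
      - ((J ∩ U).card : ℝ) * zn := by
  unfold zc
  rw [Finset.sum_congr rfl (fun K hK => term_eq hDU hdisj w zn (mem_comp.1 hK).2.1)]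
  rw [Finset.sum_sub_distrib, ← Finset.sum_mul]
  congr 1
  · rw [← Finset.sum_filter_add_sum_filter_not (cpairs n (SJ n D U J))
      (fun p => ¬ ConsecIn (Dbar n D) p.1 p.2)]
    rw [cpairs_SJ hDU hdisj hJ]
    rw [Finset.sum_eq_zero (s := (cpairs n (SJ n D U J)).filter _), add_zero,
      Finset.sum_biUnion]
    · intro K hK L hL hKL
      rw [Function.onFun, Finset.disjoint_left]
      rintro ⟨p, q⟩ h1 h2
      have hK' := mem_comp.1 hK
      have hL' := mem_comp.1 hL
      rw [mem_cpairs (TJ_subset hK'.2.1.1 hK'.2.1.2.1)] at h1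
      rw [mem_cpairs (TJ_subset hL'.2.1.1 hL'.2.1.2.1)] at h2
      have a1 := TJ_bounds hK'.2.1 h1.1
      have a2 := TJ_bounds hK'.2.1 h1.2.1
      have a3 := TJ_bounds hL'.2.1 h2.1
      have a4 := TJ_bounds hL'.2.1 h2.2.1
      have a5 := h1.2.2.1
      exact hKL (comp_eq hK hL (by omega) (by omega))
    · intro p hp
      rw [Finset.mem_filter, not_not] at hp
      exact zext_consec hDU hdisj h1D w zn hp.2
  · congr 1
    rw [← Nat.cast_sum, ← Finset.card_biUnion]
    · congr 2
      ext i
      simp only [Finset.mem_biUnion, Finset.mem_inter]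
      constructor
      · rintro ⟨K, hK, h1, h2⟩
        exact ⟨(mem_comp.1 hK).1 h1, h2⟩
      · rintro ⟨h1, h2⟩
        obtain ⟨K, hK, h⟩ := exists_comp (J := J) (nested_singleton D (hJ h1)) (by simpa using h1)
        exact ⟨K, hK, by simpa using h, h2⟩
    · intro K hK L hL hKL
      rw [Function.onFun, Finset.disjoint_left]
      intro i h1 h2
      have h1 := (Finset.mem_inter.1 h1).1
      have h2 := (Finset.mem_inter.1 h2).1
      have hK' := mem_comp.1 hK
      have hL' := mem_comp.1 hL
      have a1 := aI_lt (D := D) hK'.2.1.2.1 h1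
      have a2 := (bI_spec (D := D) hK'.2.1.2.1).2 i h1
      have a3 := aI_lt (D := D) hL'.2.1.2.1 h2
      have a4 := (bI_spec (D := D) hL'.2.1.2.1).2 i h2
      exact hKL (comp_eq hK hL (by omega) (by omega))

/-! ### Möbius inversion -/

lemma toggle_sum {I : Finset ℕ} {i : ℕ} (hi : i ∈ I) (F : Finset ℕ → ℝ)
    (hF : ∀ J ⊆ I.erase i, F (insert i J) = F J) :
    ∑ J ∈ I.powerset, (-1 : ℝ) ^ (I \ J).card * F J = 0 := by
  have hI : I = insert i (I.erase i) := (Finset.insert_erase hi).symm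
  have hs := Finset.sum_powerset_insert (Finset.notMem_erase i I)
    (fun J => (-1 : ℝ) ^ (I \ J).card * F J)
  rw [← hI] at hs
  rw [hs, ← Finset.sum_add_distrib]
  apply Finset.sum_eq_zero
  intro J hJ
  rw [Finset.mem_powerset] at hJ
  have hiJ : i ∉ J := fun h => Finset.notMem_erase i I (hJ h)
  rw [hF J hJ]
  have : (I \ J).card = (I \ insert i J).card + 1 := by
    rw [← Finset.card_insert_of_notMem (a := i) (s := I \ insert i J) (by simp)]
    congr 1
    ext x
    simp only [Finset.mem_sdiff, Finset.mem_insert]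
    by_cases h : x = i
    · subst h; simp [hi, hiJ]
    · simp [h]
  rw [this, pow_succ]
  ring

/-- The Möbius coefficient of the pair `{p,q}`. -/
noncomputable def Mc (n : ℕ) (D U I : Finset ℕ) (p q : ℕ) : ℝ :=
  ∑ J ∈ I.powerset, (-1 : ℝ) ^ (I \ J).card * (if ConsecIn (SJ n D U J) p q then 1 else 0)

/-- The Möbius inverse of `J ↦ |J ∩ U|`. -/
noncomputable def Lc (U I : Finset ℕ) : ℝ :=
  ∑ J ∈ I.powerset, (-1 : ℝ) ^ (I \ J).card * ((J ∩ U).card : ℝ)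

lemma yI_eq {n : ℕ} {D U I : Finset ℕ} (hDU : D ∪ U = Finset.Icc 1 n) (hdisj : Disjoint D U)
    (h1D : 1 ∈ D) (w : ℕ × ℕ → ℝ) (zn : ℝ) (hI : I ⊆ Finset.Icc 1 n) :
    yI n D U w zn I =
      (∑ p ∈ Finset.range (n + 2) ×ˢ Finset.range (n + 2),
        zext n D U w zn p.1 p.2 * Mc n D U I p.1 p.2) - zn * Lc U I := by
  unfold yI Mc Lc
  simp_rw [Finset.mul_sum]
  rw [Finset.sum_comm, ← Finset.sum_sub_distrib]
  apply Finset.sum_congr rfl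
  intro J hJ
  rw [Finset.mem_powerset] at hJ
  rw [zc_eq hDU hdisj h1D w zn (hJ.trans hI)]
  unfold cpairs
  rw [Finset.sum_filter, mul_sub, Finset.mul_sum]
  congr 1
  · apply Finset.sum_congr rfl
    intro p _
    split_ifs <;> ring
  · ring

lemma Lc_zero {U I : Finset ℕ} {i j : ℕ} (hi : i ∈ I) (hj : j ∈ I) (hij : i ≠ j) :
    Lc U I = 0 := by
  have hcard : ∀ J ∈ I.powerset, (-1 : ℝ) ^ (I \ J).card * ((J ∩ U).card : ℝ)
      = ∑ u ∈ U, (-1 : ℝ) ^ (I \ J).card * (if u ∈ J then 1 else 0) := by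
    intro J _
    rw [← Finset.mul_sum, Finset.sum_boole, Finset.inter_comm, Finset.filter_mem_eq_inter]
  unfold Lc
  rw [Finset.sum_congr rfl hcard, Finset.sum_comm]
  apply Finset.sum_eq_zero
  intro u _
  by_cases h : u = i
  · apply toggle_sum hj
    intro J _
    have : u ≠ j := by omega
    simp [this]
  · apply toggle_sum hi
    intro J _
    simp [h]

lemma Lc_singleton (U : Finset ℕ) (i : ℕ) : Lc U {i} = if i ∈ U then 1 else 0 := by
  unfold Lc
  have hps : ({i} : Finset ℕ).powerset = {∅, {i}} := by
    ext J
    simp [Finset.subset_singleton_iff]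
  rw [hps, Finset.sum_pair (by simp [eq_comm])]
  by_cases h : i ∈ U
  · simp [h]
  · simp [h]

lemma Mc_out {n : ℕ} {D U I : Finset ℕ} {p q i : ℕ} (hi : i ∈ I) (h : i < p ∨ q < i) :
    Mc n D U I p q = 0 := by
  unfold Mc
  by_cases hpq : p < q
  · apply toggle_sum hi
    intro J _
    have hm : ∀ x, x ≠ i → (x ∈ SJ n D U (insert i J) ↔ x ∈ SJ n D U J) := by
      intro x hx
      simp [mem_SJ, hx]
    have : ConsecIn (SJ n D U (insert i J)) p q ↔ ConsecIn (SJ n D U J) p q := by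
      unfold ConsecIn
      rw [hm p (by omega), hm q (by omega)]
      constructor
      · rintro ⟨h1, h2, h3, h4⟩
        exact ⟨h1, h2, h3, fun z hz hzz => h4 z ((hm z (by omega)).2 hz) hzz⟩
      · rintro ⟨h1, h2, h3, h4⟩
        exact ⟨h1, h2, h3, fun z hz hzz => h4 z ((hm z (by omega)).1 hz) hzz⟩
    simp only [this]
  · apply Finset.sum_eq_zero
    intro J _
    rw [if_neg (fun hc => hpq hc.2.2.1), mul_zero]

lemma Mc_bad {n : ℕ} {D U I : Finset ℕ} (hDU : D ∪ U = Finset.Icc 1 n)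
    (hne : I.Nonempty) (hI : I ⊆ Finset.Icc 1 n) {p q γ Γ : ℕ}
    (hγ : γ ∈ I) (hγm : ∀ i ∈ I, γ ≤ i) (hΓ : Γ ∈ I) (hΓm : ∀ i ∈ I, i ≤ Γ)
    (hq : q ≤ n + 1)
    (hbad : ¬ ((p = aI D I ∨ p = γ) ∧ (q = bI n D I ∨ q = Γ) ∧ IsNested n D I)) :
    Mc n D U I p q = 0 := by
  by_cases hout : ∃ i ∈ I, i < p ∨ q < i
  · obtain ⟨i, hi, h⟩ := hout
    exact Mc_out hi h
  push Not at hout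
  unfold Mc
  apply Finset.sum_eq_zero
  intro J hJ
  rw [Finset.mem_powerset] at hJ
  rw [if_neg, mul_zero]
  rintro ⟨h1, h2, h3, h4⟩
  have hSD : ∀ d ∈ D, d ∉ I → d ∈ SJ n D U J := fun d hd hdI =>
    mem_SJ.2 (Or.inl ⟨Or.inr (Or.inr hd), fun h => hdI (hJ h)⟩)
  have haI : aI D I ∉ I := fun h => absurd (aI_lt hI h) (lt_irrefl _)
  have hbI : bI n D I ∉ I := fun h => absurd ((bI_spec hI).2 _ h) (lt_irrefl _)
  have aγ := aI_lt (D := D) hI hγ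
  have bΓ := (bI_spec (D := D) hI).2 _ hΓ
  have pγ := (hout γ hγ).1
  have qΓ := (hout Γ hΓ).2
  have γΓ := hγm Γ hΓ
  apply hbad
  refine ⟨?_, ?_, ?_⟩
  · by_cases hp : p = γ
    · exact Or.inr hp
    left
    have hpI : p ∉ I := fun h => by have := hγm p h; omega
    have hple : p ≤ aI D I := by
      rcases mem_SJ.1 h1 with ⟨h | h | h, _⟩ | h
      · omega
      · omega
      · exact le_aI h (fun i hi => by have := hγm i hi; omega)
      · exact absurd (hJ h.1) hpI
    by_contra hpa
    rcases aI_mem D I with h | h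
    · omega
    · exact h4 _ (hSD _ h haI) ⟨by omega, by omega⟩
  · by_cases hq' : q = Γ
    · exact Or.inr hq'
    left
    have hqI : q ∉ I := fun h => by have := hΓm q h; omega
    have hple : bI n D I ≤ q := by
      rcases mem_SJ.1 h2 with ⟨h | h | h, _⟩ | h
      · omega
      · rw [h]; exact bI_le_n hI
      · exact bI_le (Or.inl h) (fun i hi => by have := hΓm i hi; omega)
      · exact absurd (hJ h.1) hqI
    by_contra hpa
    rcases (bI_spec (D := D) hI).1 with h | h
    · omega
    · exact h4 _ (hSD _ h hbI) ⟨by omega, by omega⟩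
  · rw [isNested_iff hne hI]
    intro d hd i hi j hj hid hdj
    by_contra hdI
    have e1 : d ≠ i := fun h => hdI (h ▸ hi)
    have e2 : d ≠ j := fun h => hdI (h ▸ hj)
    have e3 := (hout i hi).1
    have e4 := (hout j hj).2
    exact h4 d (hSD d hd hdI) ⟨by omega, by omega⟩

lemma Mc_good {n : ℕ} {D U I : Finset ℕ} (hDU : D ∪ U = Finset.Icc 1 n) (hdisj : Disjoint D U)
    (hn : IsNested n D I) {p q : ℕ} (hpq : p < q)
    (hp : p = aI D I ∨ p ∈ I) (hq : q = bI n D I ∨ q ∈ I)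
    (hout : ∀ i ∈ I, p ≤ i ∧ i ≤ q) :
    Mc n D U I p q = (-1 : ℝ) ^ (I ∩ U).card * ((if p ∈ I then -1 else 1) * (if q ∈ I then -1 else 1)) := by
  have hI := hn.2.1
  have hID : ∀ x ∈ I, (x ∈ D ∨ x ∈ U) ∧ ¬ (x ∈ D ∧ x ∈ U) := by
    intro x hx
    have : x ∈ D ∪ U := hDU ▸ hI hx
    exact ⟨Finset.mem_union.1 this, fun h => Finset.disjoint_left.1 hdisj h.1 h.2⟩
  have haI : aI D I ∉ I := fun h => absurd (aI_lt hI h) (lt_irrefl _)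
  have hbI : bI n D I ∉ I := fun h => absurd ((bI_spec hI).2 _ h) (lt_irrefl _)
  have hap : aI D I ≤ p := by
    rcases hp with h | h
    · omega
    · exact (aI_lt hI h).le
  have hbq : q ≤ bI n D I := by
    rcases hq with h | h
    · omega
    · exact ((bI_spec hI).2 _ h).le
  have hbn := bI_le_n (D := D) hI
  let J0 := I.filter fun x => (x ∈ D ∧ x ≠ p ∧ x ≠ q) ∨ (x ∈ U ∧ (x = p ∨ x = q))
  have hJ0 : ∀ x, x ∈ J0 ↔ x ∈ I ∧ ((x ∈ D ∧ x ≠ p ∧ x ≠ q) ∨ (x ∈ U ∧ (x = p ∨ x = q))) :=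
    fun x => Finset.mem_filter
  have hJ0I : J0 ⊆ I := Finset.filter_subset _ _
  clear_value J0
  have hend : ∀ x, (x = p ∨ x = q) → (x ∈ I ∨ x = 0 ∨ x = n + 1 ∨ x ∈ D) := by
    rintro x (rfl | rfl)
    · rcases hp with h | h
      · rcases aI_mem D I with g | g
        · right; left; omega
        · right; right; right; rw [h]; exact g
      · exact Or.inl h
    · rcases hq with h | h
      · rcases (bI_spec (D := D) hI).1 with g | g
        · right; right; left; omega
        · right; right; right; rw [h]; exact g
      · exact Or.inl h
  have hendS : ∀ x, (x = p ∨ x = q) → x ∈ SJ n D U J0 := by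
    intro x hx
    rw [mem_SJ, hJ0]
    have h1 := hend x hx
    have h2 := hID x
    grind
  have hS0 : ConsecIn (SJ n D U J0) p q := by
    refine ⟨hendS p (Or.inl rfl), hendS q (Or.inr rfl), hpq, ?_⟩
    rintro r hr ⟨h1, h2⟩
    have hrp : r ≠ p := by omega
    have hrq : r ≠ q := by omega
    rcases mem_SJ.1 hr with ⟨h | h | h, h'⟩ | h
    · omega
    · omega
    · exact h' ((hJ0 r).2 ⟨hn.2.2 r h (by omega) (by omega), Or.inl ⟨h, hrp, hrq⟩⟩)
    · have h3 := (hJ0 r).1 h.1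
      have := hID r h3.1
      grind
  have huniq : ∀ J ⊆ I, ConsecIn (SJ n D U J) p q → J = J0 := by
    rintro J hJ ⟨h1, h2, _, h4⟩
    ext x
    by_cases hx : x ∈ I
    · rw [hJ0]
      have g1 := hID x hx
      have g2 := hI hx
      rw [Finset.mem_Icc] at g2
      by_cases hxe : x = p ∨ x = q
      · have : x ∈ SJ n D U J := by rcases hxe with rfl | rfl <;> assumption
        rw [mem_SJ] at this
        have e1 : x ≠ 0 := by omega
        have e2 : x ≠ n + 1 := by omega
        grind
      · have g3 := hout x hx
        push Not at hxe
        have : x ∉ SJ n D U J := fun h => h4 x h ⟨by omega, by omega⟩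
        rw [mem_SJ] at this
        grind
    · exact ⟨fun h => absurd (hJ h) hx, fun h => absurd (hJ0I h) hx⟩
  unfold Mc
  rw [Finset.sum_eq_single J0, if_pos hS0, mul_one]
  · have hcard : (-1 : ℝ) ^ (I \ J0).card = ∏ x ∈ I, (if x ∈ J0 then 1 else -1) := by
      rw [Finset.prod_ite, Finset.prod_const_one, one_mul, Finset.prod_const,
        Finset.filter_notMem_eq_sdiff]
    have hcardU : (-1 : ℝ) ^ (I ∩ U).card = ∏ x ∈ I, (if x ∈ U then -1 else 1) := by
      rw [Finset.prod_ite, Finset.prod_const_one, mul_one, Finset.prod_const,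
        Finset.filter_mem_eq_inter]
    have hpp : ∀ r : ℕ, (if r ∈ I then (-1 : ℝ) else 1) = ∏ x ∈ I, (if x = r then -1 else 1) := by
      intro r
      rw [Finset.prod_ite_eq']
    rw [hcard, hcardU, hpp p, hpp q, ← Finset.prod_mul_distrib, ← Finset.prod_mul_distrib]
    apply Finset.prod_congr rfl
    intro x hx
    have g1 := hID x hx
    by_cases hxp : x = p
    · have hxq : x ≠ q := by omega
      by_cases hxU : x ∈ U
      · have : x ∈ J0 := by rw [hJ0]; grind
        rw [if_pos this, if_pos hxU, if_pos hxp, if_neg hxq]; norm_num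
      · have : x ∉ J0 := by rw [hJ0]; grind
        rw [if_neg this, if_neg hxU, if_pos hxp, if_neg hxq]; norm_num
    · by_cases hxq : x = q
      · by_cases hxU : x ∈ U
        · have : x ∈ J0 := by rw [hJ0]; grind
          rw [if_pos this, if_pos hxU, if_neg hxp, if_pos hxq]; norm_num
        · have : x ∉ J0 := by rw [hJ0]; grind
          rw [if_neg this, if_neg hxU, if_neg hxp, if_pos hxq]; norm_num
      · by_cases hxU : x ∈ U
        · have : x ∉ J0 := by rw [hJ0]; grind
          rw [if_neg this, if_pos hxU, if_neg hxp, if_neg hxq]; norm_num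
        · have : x ∈ J0 := by rw [hJ0]; grind
          rw [if_pos this, if_neg hxU, if_neg hxp, if_neg hxq]; norm_num
  · intro J hJ hne
    rw [Finset.mem_powerset] at hJ
    rw [if_neg (fun h => hne (huniq J hJ h)), mul_zero]
  · intro h
    exact absurd (Finset.mem_powerset.2 hJ0I) h

lemma sign_eq {n : ℕ} {D U I : Finset ℕ} (hDU : D ∪ U = Finset.Icc 1 n) (hdisj : Disjoint D U)
    (hn : IsNested n D I) :
    I \ Rext n D U (aI D I) (bI n D I) = I ∩ U := by
  have hI := hn.2.1
  have hU : U ⊆ Finset.Icc 1 n := hDU ▸ Finset.subset_union_right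
  have hID : ∀ x ∈ I, (x ∈ D ∨ x ∈ U) ∧ ¬ (x ∈ D ∧ x ∈ U) := by
    intro x hx
    have : x ∈ D ∪ U := hDU ▸ hI hx
    exact ⟨Finset.mem_union.1 this, fun h => Finset.disjoint_left.1 hdisj h.1 h.2⟩
  have hbn := bI_le_n (D := D) hI
  have hab : aI D I < bI n D I := by
    obtain ⟨i, hi⟩ := hn.1
    exact (aI_lt hI hi).trans ((bI_spec hI).2 i hi)
  have haU : aI D I ∉ U := by
    intro h
    rcases aI_mem D I with g | g
    · have := hU h; rw [Finset.mem_Icc] at this; omega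
    · exact Finset.disjoint_left.1 hdisj g h
  have hbU : bI n D I ∉ U := by
    intro h
    rcases (bI_spec (D := D) hI).1 with g | g
    · have := hU h; rw [Finset.mem_Icc] at this; omega
    · exact Finset.disjoint_left.1 hdisj g h
  unfold Rext
  by_cases h1 : IsProper n D U (aI D I) (bI n D I)
  · rw [if_pos h1]
    unfold Rdiag
    rw [if_neg haU, if_neg hbU]
    ext x
    rw [Finset.mem_sdiff, Finset.mem_inter, Finset.mem_filter]
    constructor
    · rintro ⟨hx, h⟩
      have g1 := aI_lt (D := D) hI hx
      have g2 := (bI_spec (D := D) hI).2 x hx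
      have := hID x hx
      tauto
    · rintro ⟨hx, h⟩
      have := hID x hx
      tauto
  · rw [if_neg h1]
    by_cases h2 : U = ∅ ∧ aI D I = 0 ∧ bI n D I = n + 1
    · rw [if_pos h2, h2.1, Finset.inter_empty, Finset.sdiff_eq_empty_iff_subset]
      exact hI
    · rw [if_neg h2, if_neg (by tauto), Finset.sdiff_empty]
      have hbd : IsBoundary n D U (aI D I) (bI n D I) := by
        by_contra h
        exact h1 ⟨hab, hbn, h⟩
      rcases hbd with h | ⟨_, h | h | h⟩ | h
      · symm
        rw [Finset.inter_eq_left]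
        intro i hi
        have g1 := aI_lt (D := D) hI hi
        have g2 := (bI_spec (D := D) hI).2 i hi
        rcases (hID i hi).1 with g | g
        · exact absurd ⟨g1, g2⟩ (h.2.2.2 i (by simp [Dbar, g]))
        · exact g
      · exact absurd h.2.1 hbU
      · exact absurd h.2.1 haU
      · exact absurd h.1 haU
      · exact absurd h h2

lemma minEl_spec {I : Finset ℕ} (hne : I.Nonempty) :
    minEl I ∈ I ∧ ∀ i ∈ I, minEl I ≤ i := by
  constructor
  · exact Nat.sInf_mem (s := {i : ℕ | i ∈ I}) hne
  · intro i hi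
    exact Nat.sInf_le hi

lemma maxEl_spec {I : Finset ℕ} (hne : I.Nonempty) :
    maxEl I ∈ I ∧ ∀ i ∈ I, i ≤ maxEl I := by
  constructor
  · obtain ⟨x, hx, h⟩ := Finset.exists_mem_eq_sup I hne id
    unfold maxEl
    rw [h]; exact hx
  · intro i hi
    exact Finset.le_sup (f := id) hi

lemma yI_nested {n : ℕ} {D U I : Finset ℕ} (hDU : D ∪ U = Finset.Icc 1 n) (hdisj : Disjoint D U)
    (h1D : 1 ∈ D) (w : ℕ × ℕ → ℝ) (zn : ℝ) (hn : IsNested n D I) :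
    yI n D U w zn I = (-1 : ℝ) ^ (I ∩ U).card *
            (zext n D U w zn (aI D I) (bI n D I)
              - zext n D U w zn (aI D I) (maxEl I)
              - zext n D U w zn (minEl I) (bI n D I)
              + zext n D U w zn (minEl I) (maxEl I)) := by
  have hI := hn.2.1
  obtain ⟨hγ, hγm⟩ := minEl_spec hn.1
  obtain ⟨hΓ, hΓm⟩ := maxEl_spec hn.1
  rw [yI_eq hDU hdisj h1D w zn hI]
  set γ := minEl I
  set Γ := maxEl I
  set a := aI D I with ha
  set b := bI n D I with hb
  have haI : a ∉ I := fun h => absurd (aI_lt hI h) (lt_irrefl _)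
  have hbI : b ∉ I := fun h => absurd ((bI_spec hI).2 _ h) (lt_irrefl _)
  have aγ : a < γ := aI_lt (D := D) hI hγ
  have bΓ : Γ < b := (bI_spec (D := D) hI).2 _ hΓ
  have γΓ := hγm Γ hΓ
  have hbn : b ≤ n + 1 := bI_le_n (D := D) hI
  have hsum : (∑ p ∈ Finset.range (n + 2) ×ˢ Finset.range (n + 2),
        zext n D U w zn p.1 p.2 * Mc n D U I p.1 p.2)
      = ∑ p ∈ ({a, γ} : Finset ℕ) ×ˢ ({b, Γ} : Finset ℕ),
        zext n D U w zn p.1 p.2 * Mc n D U I p.1 p.2 := by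
    symm
    apply Finset.sum_subset
    · rintro ⟨p, q⟩ h
      simp only [Finset.mem_product, Finset.mem_insert, Finset.mem_singleton, Finset.mem_range] at *
      omega
    · rintro ⟨p, q⟩ h1 h2
      simp only [Finset.mem_product, Finset.mem_insert, Finset.mem_singleton, Finset.mem_range] at *
      rw [Mc_bad hDU hn.1 hI hγ hγm hΓ hΓm (by omega) (fun h => h2 ⟨h.1, h.2.1⟩), mul_zero]
  rw [hsum, Finset.sum_product, Finset.sum_pair (by omega), Finset.sum_pair (by omega),
    Finset.sum_pair (by omega)]
  simp only
  have m1 : Mc n D U I a b = (-1 : ℝ) ^ (I ∩ U).card := by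
    rw [Mc_good hDU hdisj hn (by omega) (Or.inl rfl) (Or.inl rfl)
      (fun i hi => by have := hγm i hi; have := hΓm i hi; omega), if_neg haI, if_neg hbI]
    ring
  have m2 : Mc n D U I a Γ = -(-1 : ℝ) ^ (I ∩ U).card := by
    rw [Mc_good hDU hdisj hn (by omega) (Or.inl rfl) (Or.inr hΓ)
      (fun i hi => by have := hγm i hi; have := hΓm i hi; omega), if_neg haI, if_pos hΓ]
    ring
  have m3 : Mc n D U I γ b = -(-1 : ℝ) ^ (I ∩ U).card := by
    rw [Mc_good hDU hdisj hn (by omega) (Or.inr hγ) (Or.inl rfl)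
      (fun i hi => by have := hγm i hi; have := hΓm i hi; omega), if_pos hγ, if_neg hbI]
    ring
  rw [m1, m2, m3]
  by_cases hlt : γ < Γ
  · have m4 : Mc n D U I γ Γ = (-1 : ℝ) ^ (I ∩ U).card := by
      rw [Mc_good hDU hdisj hn hlt (Or.inr hγ) (Or.inr hΓ)
        (fun i hi => by have := hγm i hi; have := hΓm i hi; omega), if_pos hγ, if_pos hΓ]
      ring
    rw [m4, Lc_zero hγ hΓ (by omega)]
    ring
  · have heq : Γ = γ := by omega
    have m4 : Mc n D U I γ Γ = 0 := by
      unfold Mc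
      apply Finset.sum_eq_zero
      intro J _
      rw [if_neg (fun hc => hlt hc.2.2.1), mul_zero]
    have hIs : I = {γ} := by
      ext x
      rw [Finset.mem_singleton]
      constructor
      · intro hx
        have := hγm x hx
        have := hΓm x hx
        omega
      · rintro rfl; exact hγ
    have hL : Lc U I = if γ ∈ U then 1 else 0 := by
      rw [hIs]; exact Lc_singleton U γ
    have hz : zext n D U w zn γ Γ = if γ ∈ U then zn else 0 := by
      unfold zext
      have hγ1 := Finset.mem_Icc.1 (hI hγ)
      rw [if_neg (fun h => hlt h.1), if_neg (fun h => by omega), heq]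
      simp
    rw [m4, hL, hz]
    by_cases hγU : γ ∈ U
    · have : I ∩ U = {γ} := by
        rw [hIs]; exact Finset.singleton_inter_of_mem hγU
      rw [this, if_pos hγU, if_pos hγU, Finset.card_singleton]
      ring
    · rw [if_neg hγU, if_neg hγU]
      ring

lemma yI_not_nested {n : ℕ} {D U I : Finset ℕ} (hDU : D ∪ U = Finset.Icc 1 n)
    (hdisj : Disjoint D U) (h1D : 1 ∈ D) (w : ℕ × ℕ → ℝ) (zn : ℝ)
    (hne : I.Nonempty) (hI : I ⊆ Finset.Icc 1 n) (hn : ¬ IsNested n D I) :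
    yI n D U w zn I = 0 := by
  obtain ⟨hγ, hγm⟩ := minEl_spec hne
  obtain ⟨hΓ, hΓm⟩ := maxEl_spec hne
  rw [yI_eq hDU hdisj h1D w zn hI, Finset.sum_eq_zero, Lc_zero hγ hΓ]
  · ring
  · intro h
    apply hn
    have hIs : I = {minEl I} := by
      ext x
      rw [Finset.mem_singleton]
      constructor
      · intro hx
        have := hγm x hx
        have := hΓm x hx
        omega
      · intro hx; rw [hx]; exact hγ
    rw [hIs]
    exact nested_singleton D (hI hγ)
  · intro p hp
    have := Finset.mem_range.1 (Finset.mem_product.1 hp).2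
    rw [Mc_bad hDU hne hI hγ hγm hΓ hΓm (by omega) (fun h => hn h.2.2), mul_zero]

/-- if `v(I) = 1` (`I` nested) then
`y_I = (−1)^{|I∖R_{δ_1}|}(z_{R_{δ_1}} − z_{R_{δ_2}} − z_{R_{δ_3}} + z_{R_{δ_4}})`
(with extended `R` and `z`); if `v(I) ≥ 2` then `y_I = 0`. -/
theorem statement1 (n : ℕ) (D U : Finset ℕ) (hn : 2 ≤ n)
    (hDU : D ∪ U = Finset.Icc 1 n) (hdisj : Disjoint D U) (h1D : 1 ∈ D) (hnD : n ∈ D)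
    (w : ℕ × ℕ → ℝ) (zn : ℝ)
    (I : Finset ℕ) (hne : I.Nonempty) (hsub : I ⊆ Finset.Icc 1 n) :
    (vI n D I = 1 →
        yI n D U w zn I =
          (-1 : ℝ) ^ (I \ Rext n D U (aI D I) (bI n D I)).card *
            (zext n D U w zn (aI D I) (bI n D I)
              - zext n D U w zn (aI D I) (maxEl I)
              - zext n D U w zn (minEl I) (bI n D I)
              + zext n D U w zn (minEl I) (maxEl I)))
    ∧ (2 ≤ vI n D I → yI n D U w zn I = 0) := by
  constructor
  · intro h
    have hnest := (nested_iff_vI hne hsub).1 h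
    rw [sign_eq hDU hdisj hnest]
    exact yI_nested hDU hdisj h1D w zn hnest
  · intro h
    apply yI_not_nested hDU hdisj h1D w zn hne hsub
    intro hnest
    have := (nested_iff_vI hne hsub).2 hnest
    omega

end AssocPaper
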